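/- For every string s over 𝒜 with |s| = l ≤ D, the CTW weighted probability admits the subtree decomposition p^w_{n,s} = Σ_{U ∈ 𝒯(D−l)} π_{D−l}(U) · Π_{u ∈ ℒ(U)} p^e_{n,us}, where the sum ranges over all context trees U of depth at most D−l, π_{D−l} is the branching-process prior with maximum depth D−l, and us denotes the string obtained by prepending the string u before s. -/

import Mathlib

open scoped Classical

noncomputable section

variable {𝒜 : Type*}

/-- The finset of all strings over `𝒜` of length at most `D`. -/
def stringsLe (𝒜 : Type*) [Fintype 𝒜] (D : ℕ) : Finset (List 𝒜) :=
  Set.Finite.toFinset (List.finite_length_le 𝒜 D)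

/-- A context tree of maximum depth `D`, identified with its leaf set: every leaf has length
at most `D`, no leaf is a (proper) suffix of another, and every string of length `D` has
exactly one suffix among the leaves. -/
def IsContextTree (D : ℕ) (T : Finset (List 𝒜)) : Prop :=
  (∀ s ∈ T, s.length ≤ D) ∧
  (∀ s ∈ T, ∀ t ∈ T, s <:+ t → s = t) ∧
  (∀ w : List 𝒜, w.length = D → ∃! s, s ∈ T ∧ s <:+ w)

/-- The finset of all context trees of maximum depth `D`. -/
def contextTrees (𝒜 : Type*) [Fintype 𝒜] (D : ℕ) : Finset (Finset (List 𝒜)) :=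
  (stringsLe 𝒜 D).powerset.filter (IsContextTree D)

/-- The branching-process prior `π_D` on context trees. -/
def priorD [Fintype 𝒜] (lam : ℝ) (D : ℕ) (T : Finset (List 𝒜)) : ℝ :=
  (1 - lam) ^ ((T.card - 1) / (Fintype.card 𝒜 - 1)) *
    lam ^ (T.card - (T.filter (fun s => s.length = D)).card)

/-- The window `(x_{1-D}, …, x_{j-1})`. -/
def window (x : ℤ → 𝒜) (D : ℕ) (j : ℕ) : List 𝒜 :=
  (List.range (D + j - 1)).map (fun i => x (1 - (D : ℤ) + (i : ℤ)))

/-- The counting vector `𝐧_{n,s}(a)`. -/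
def cnt [DecidableEq 𝒜] (x : ℤ → 𝒜) (D n : ℕ) (s : List 𝒜) (a : 𝒜) : ℕ :=
  ((Finset.Icc 1 n).filter (fun (j : ℕ) => x (j : ℤ) = a ∧ s <:+ window x D j)).card

/-- The evidence value `P^e(m)` of a counting vector `m` under Dirichlet parameters `α`. -/
def pEv [Fintype 𝒜] (α : 𝒜 → ℝ) (m : 𝒜 → ℕ) : ℝ :=
  (Real.Gamma (∑ a, α a) / Real.Gamma (∑ a, ((m a : ℝ) + α a))) *
    ∏ a, (Real.Gamma ((m a : ℝ) + α a) / Real.Gamma (α a))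

/-- The evidence `p^e_{n,s}`. -/
def pE [Fintype 𝒜] [DecidableEq 𝒜] (α : 𝒜 → ℝ) (x : ℤ → 𝒜) (D n : ℕ) (s : List 𝒜) : ℝ :=
  pEv α (cnt x D n s)

/-- Auxiliary downward recursion for the CTW weighted probabilities, with fuel `k = D - |s|`. -/
def pWaux [Fintype 𝒜] [DecidableEq 𝒜] (α : 𝒜 → ℝ) (lam : ℝ) (x : ℤ → 𝒜) (D n : ℕ) :
    ℕ → List 𝒜 → ℝ
  | 0, s => pE α x D n s
  | k + 1, s => lam * pE α x D n s + (1 - lam) * ∏ q, pWaux α lam x D n k (q :: s)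

/-- The CTW weighted probability `p^w_{n,s}`. -/
def pW [Fintype 𝒜] [DecidableEq 𝒜] (α : 𝒜 → ℝ) (lam : ℝ) (x : ℤ → 𝒜) (D n : ℕ)
    (s : List 𝒜) : ℝ :=
  pWaux α lam x D n (D - s.length) s

/-- The observed suffix `s_{n,l} = (x_{n-l+1}, …, x_n)` of length `l`. -/
def sfx (x : ℤ → 𝒜) (n : ℤ) (l : ℕ) : List 𝒜 :=
  (List.range l).map (fun i => x (n - (l : ℤ) + 1 + (i : ℤ)))

/-- The CTW mixture weight `ω_{n,l}`. -/
def omegaW [Fintype 𝒜] [DecidableEq 𝒜] (α : 𝒜 → ℝ) (lam : ℝ) (x : ℤ → 𝒜) (D n l : ℕ) : ℝ :=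
  (∑ T ∈ (contextTrees 𝒜 D).filter (fun T => sfx x n l ∈ T),
      priorD lam D T * ∏ s ∈ T, pE α x D n s) / pW α lam x D n []

/-- The per-suffix Bayesian predictor `p̄_{n,s}(a)`. -/
def pBar [Fintype 𝒜] [DecidableEq 𝒜] (α : 𝒜 → ℝ) (x : ℤ → 𝒜) (D n : ℕ) (s : List 𝒜)
    (a : 𝒜) : ℝ :=
  (α a + cnt x D n s a) / ∑ q, (α q + cnt x D n s q)

end

section ContextTreeGrafting

open Finset

variable {𝒜 : Type*}

/-- A string ending in `q` is a suffix of a string ending in `r` iff `q = r` and the remaining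
initial parts are suffixes of one another. -/
theorem append_singleton_suffix_iff {u v : List 𝒜} {q r : 𝒜} :
    u ++ [q] <:+ v ++ [r] ↔ q = r ∧ u <:+ v := by
  rw [← List.reverse_prefix, ← List.reverse_prefix (l₁ := u)]
  simp [List.cons_prefix_cons]

/-- A context tree containing the empty string is the single-leaf tree. -/
theorem IsContextTree.eq_singleton_nil {D : ℕ} {T : Finset (List 𝒜)} (hT : IsContextTree D T)
    (h : [] ∈ T) : T = {[]} :=
  Finset.eq_singleton_iff_unique_mem.2
    ⟨h, fun s hs => (hT.2.1 [] h s hs (List.nil_suffix)).symm⟩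

theorem isContextTree_singleton_nil (D : ℕ) : IsContextTree D ({[]} : Finset (List 𝒜)) := by
  refine ⟨by simp, by simp, fun w _ => ⟨[], by simp, by simp⟩⟩

theorem isContextTree_zero_iff {T : Finset (List 𝒜)} : IsContextTree 0 T ↔ T = {[]} := by
  refine ⟨fun hT => hT.eq_singleton_nil ?_, fun h => h ▸ isContextTree_singleton_nil 0⟩
  obtain ⟨s, ⟨hs, hsuf⟩, -⟩ := hT.2.2 [] rfl
  rwa [List.suffix_nil.1 hsuf] at hs

/-- The subtree of `T` hanging from the child `q` of the root. -/
noncomputable def branch (T : Finset (List 𝒜)) (q : 𝒜) : Finset (List 𝒜) :=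
  T.preimage (· ++ [q]) (List.append_left_injective [q]).injOn

@[simp]
theorem mem_branch {T : Finset (List 𝒜)} {q : 𝒜} {u : List 𝒜} :
    u ∈ branch T q ↔ u ++ [q] ∈ T := by
  simp [branch]

/-- A context tree other than the single-leaf tree is described by its branches. -/
theorem isContextTree_succ_iff_branch {D : ℕ} {T : Finset (List 𝒜)} (h : [] ∉ T) :
    IsContextTree (D + 1) T ↔ ∀ q, IsContextTree D (branch T q) := by
  constructor
  · rintro ⟨hlen, hanti, hcov⟩ q
    refine ⟨fun u hu => ?_, fun u hu v hv huv => ?_, fun w hw => ?_⟩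
    · simpa using hlen _ (mem_branch.1 hu)
    · exact List.append_cancel_right (hanti _ (mem_branch.1 hu) _ (mem_branch.1 hv)
        (append_singleton_suffix_iff.2 ⟨rfl, huv⟩))
    · obtain ⟨s, ⟨hs, hsuf⟩, huniq⟩ := hcov (w ++ [q]) (by simp [hw])
      rcases List.eq_nil_or_concat' s with rfl | ⟨u, r, rfl⟩
      · exact absurd hs h
      · obtain ⟨rfl, hu⟩ := append_singleton_suffix_iff.1 hsuf
        exact ⟨u, ⟨mem_branch.2 hs, hu⟩, fun v hv => List.append_cancel_right
          (huniq (v ++ [r]) ⟨mem_branch.1 hv.1, append_singleton_suffix_iff.2 ⟨rfl, hv.2⟩⟩)⟩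
  · intro hB
    refine ⟨fun s hs => ?_, fun s hs t ht hst => ?_, fun w hw => ?_⟩
    · rcases List.eq_nil_or_concat' s with rfl | ⟨u, q, rfl⟩
      · exact absurd hs h
      · simpa using (hB q).1 u (mem_branch.2 hs)
    · rcases List.eq_nil_or_concat' s with rfl | ⟨u, q, rfl⟩
      · exact absurd hs h
      rcases List.eq_nil_or_concat' t with rfl | ⟨v, r, rfl⟩
      · exact absurd ht h
      obtain ⟨rfl, huv⟩ := append_singleton_suffix_iff.1 hst
      rw [(hB q).2.1 u (mem_branch.2 hs) v (mem_branch.2 ht) huv]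
    · rcases List.eq_nil_or_concat' w with rfl | ⟨w, q, rfl⟩
      · simp at hw
      obtain ⟨u, ⟨hu, hsuf⟩, huniq⟩ := (hB q).2.2 w (by simpa using hw)
      refine ⟨u ++ [q], ⟨mem_branch.1 hu, append_singleton_suffix_iff.2 ⟨rfl, hsuf⟩⟩, ?_⟩
      rintro t ⟨ht, htw⟩
      rcases List.eq_nil_or_concat' t with rfl | ⟨v, r, rfl⟩
      · exact absurd ht h
      obtain ⟨rfl, hv⟩ := append_singleton_suffix_iff.1 htw
      rw [huniq v ⟨mem_branch.2 ht, hv⟩]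

variable [Fintype 𝒜]

@[simp]
theorem mem_contextTrees {D : ℕ} {T : Finset (List 𝒜)} :
    T ∈ contextTrees 𝒜 D ↔ IsContextTree D T := by
  simp only [contextTrees, Finset.mem_filter, Finset.mem_powerset, and_iff_right_iff_imp]
  intro hT s hs
  simpa [stringsLe] using hT.1 s hs

/-- The tree obtained by hanging the tree `t q` from the child `q` of the root, for every `q`. -/
noncomputable def graft (t : 𝒜 → Finset (List 𝒜)) : Finset (List 𝒜) :=
  Finset.univ.biUnion fun q => (t q).map ⟨(· ++ [q]), List.append_left_injective [q]⟩

theorem nil_notMem_graft (t : 𝒜 → Finset (List 𝒜)) : [] ∉ graft t := by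
  simp [graft]

@[simp]
theorem append_singleton_mem_graft {t : 𝒜 → Finset (List 𝒜)} {u : List 𝒜} {q : 𝒜} :
    u ++ [q] ∈ graft t ↔ u ∈ t q := by
  simp [graft]

@[simp]
theorem branch_graft (t : 𝒜 → Finset (List 𝒜)) : branch (graft t) = t := by
  ext q u
  simp

theorem graft_branch {T : Finset (List 𝒜)} (h : [] ∉ T) : graft (branch T) = T := by
  ext s
  rcases List.eq_nil_or_concat' s with rfl | ⟨u, q, rfl⟩
  · simp [h, nil_notMem_graft]
  · simp

theorem isContextTree_graft_iff {D : ℕ} {t : 𝒜 → Finset (List 𝒜)} :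
    IsContextTree (D + 1) (graft t) ↔ ∀ q, IsContextTree D (t q) := by
  rw [isContextTree_succ_iff_branch (nil_notMem_graft t), branch_graft]

theorem prod_graft {M : Type*} [CommMonoid M] (t : 𝒜 → Finset (List 𝒜)) (f : List 𝒜 → M) :
    ∏ u ∈ graft t, f u = ∏ q, ∏ u ∈ t q, f (u ++ [q]) := by
  rw [graft, Finset.prod_biUnion]
  · simp
  · intro q _ r _ hqr
    simp only [Function.onFun, Finset.disjoint_left, Finset.mem_map, Function.Embedding.coeFn_mk]
    rintro _ ⟨u, -, rfl⟩ ⟨v, -, huv⟩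
    exact hqr (by simpa using (List.append_inj' huv rfl).2.symm)

theorem sum_graft (t : 𝒜 → Finset (List 𝒜)) (f : List 𝒜 → ℕ) :
    ∑ u ∈ graft t, f u = ∑ q, ∑ u ∈ t q, f (u ++ [q]) :=
  Multiplicative.ofAdd.injective (by
    simpa only [ofAdd_sum] using prod_graft t fun u => Multiplicative.ofAdd (f u))

theorem card_graft (t : 𝒜 → Finset (List 𝒜)) : (graft t).card = ∑ q, (t q).card := by
  simpa using sum_graft t fun _ => 1

theorem card_filter_length_graft (D : ℕ) (t : 𝒜 → Finset (List 𝒜)) :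
    ((graft t).filter fun s => s.length = D + 1).card =
      ∑ q, ((t q).filter fun s => s.length = D).card := by
  simp only [Finset.card_filter, sum_graft, List.length_append, List.length_singleton,
    Nat.add_right_cancel_iff]

/-- The number of leaves of a context tree is `1 + (A - 1) m`, with `m` the number of internal
nodes. -/
theorem IsContextTree.exists_card_eq (hA : 1 ≤ Fintype.card 𝒜) {D : ℕ} {T : Finset (List 𝒜)}
    (hT : IsContextTree D T) : ∃ m, T.card = 1 + (Fintype.card 𝒜 - 1) * m := by
  induction D generalizing T with
  | zero => exact ⟨0, by simp [isContextTree_zero_iff.1 hT]⟩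
  | succ D ih =>
    by_cases h : [] ∈ T
    · exact ⟨0, by simp [hT.eq_singleton_nil h]⟩
    · choose m hm using fun q => ih ((isContextTree_succ_iff_branch h).1 hT q)
      refine ⟨1 + ∑ q, m q, ?_⟩
      rw [← graft_branch h, card_graft, Finset.sum_congr rfl fun q _ => hm q,
        Finset.sum_add_distrib, ← Finset.mul_sum, mul_add]
      simp only [sum_const, card_univ, smul_eq_mul, mul_one]
      omega

theorem priorD_zero_singleton_nil (lam : ℝ) :
    priorD lam 0 ({[]} : Finset (List 𝒜)) = 1 := by
  simp [priorD, Finset.filter_singleton]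

theorem priorD_succ_singleton_nil (lam : ℝ) (D : ℕ) :
    priorD lam (D + 1) ({[]} : Finset (List 𝒜)) = lam := by
  simp [priorD, Finset.filter_singleton]

/-- The branching-process prior factorizes over the branches at the root. -/
theorem priorD_graft (hA : 2 ≤ Fintype.card 𝒜) (lam : ℝ) {D : ℕ} {t : 𝒜 → Finset (List 𝒜)}
    (ht : ∀ q, IsContextTree D (t q)) :
    priorD lam (D + 1) (graft t) = (1 - lam) * ∏ q, priorD lam D (t q) := by
  choose m hm using fun q => (ht q).exists_card_eq (by omega)
  have hA' : 0 < Fintype.card 𝒜 - 1 := by omega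
  have hq (q : 𝒜) : ((t q).card - 1) / (Fintype.card 𝒜 - 1) = m q := by
    rw [hm, Nat.add_sub_cancel_left, Nat.mul_div_cancel_left _ hA']
  have hcard : ((graft t).card - 1) / (Fintype.card 𝒜 - 1) = 1 + ∑ q, m q := by
    have : (graft t).card - 1 = (Fintype.card 𝒜 - 1) * (1 + ∑ q, m q) := by
      rw [card_graft, Finset.sum_congr rfl fun q _ => hm q,
        Finset.sum_add_distrib, ← Finset.mul_sum, mul_add]
      simp only [sum_const, card_univ, smul_eq_mul, mul_one]
      omega
    rw [this, Nat.mul_div_cancel_left _ hA']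
  simp only [priorD, hcard, hq, Finset.prod_mul_distrib, Finset.prod_pow_eq_pow_sum]
  rw [card_filter_length_graft, card_graft,
    Finset.sum_tsub_distrib _ fun q _ => Finset.card_filter_le _ _, pow_add, pow_one, mul_assoc]

/-- Summation over context trees, split according to whether the root is a leaf. -/
theorem sum_contextTrees_succ {M : Type*} [AddCommMonoid M] (D : ℕ)
    (F : Finset (List 𝒜) → M) :
    ∑ U ∈ contextTrees 𝒜 (D + 1), F U =
      F {[]} + ∑ t ∈ Fintype.piFinset fun _ : 𝒜 => contextTrees 𝒜 D, F (graft t) := by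
  have hmem : ({[]} : Finset (List 𝒜)) ∈ contextTrees 𝒜 (D + 1) :=
    mem_contextTrees.2 (isContextTree_singleton_nil _)
  rw [← Finset.add_sum_erase _ _ hmem]
  congr 1
  have hnil {U : Finset (List 𝒜)} (hU : U ∈ (contextTrees 𝒜 (D + 1)).erase {[]}) : [] ∉ U := by
    rw [Finset.mem_erase, mem_contextTrees] at hU
    exact fun h => hU.1 (hU.2.eq_singleton_nil h)
  refine Finset.sum_bij' (fun U _ => branch U) (fun t _ => graft t) ?_ ?_ ?_ ?_ ?_
  · intro U hU
    simpa only [Fintype.mem_piFinset, mem_contextTrees] using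
      (isContextTree_succ_iff_branch (hnil hU)).1 (mem_contextTrees.1 (Finset.mem_of_mem_erase hU))
  · intro t ht
    simp only [Fintype.mem_piFinset, mem_contextTrees] at ht
    refine Finset.mem_erase.2 ⟨fun h => nil_notMem_graft t (by simp [h]), ?_⟩
    exact mem_contextTrees.2 (isContextTree_graft_iff.2 ht)
  · exact fun U hU => graft_branch (hnil hU)
  · exact fun t _ => branch_graft t
  · intro U hU
    rw [graft_branch (hnil hU)]

theorem pWaux_eq_sum_contextTrees [DecidableEq 𝒜] (hA : 2 ≤ Fintype.card 𝒜) (α : 𝒜 → ℝ)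
    (lam : ℝ) (x : ℤ → 𝒜) (D n k : ℕ) (s : List 𝒜) :
    pWaux α lam x D n k s =
      ∑ U ∈ contextTrees 𝒜 k, priorD lam k U * ∏ u ∈ U, pE α x D n (u ++ s) := by
  induction k generalizing s with
  | zero =>
    have : contextTrees 𝒜 0 = {{[]}} := by
      ext T
      simp [isContextTree_zero_iff]
    simp [this, pWaux, priorD_zero_singleton_nil]
  | succ k ih =>
    rw [sum_contextTrees_succ, pWaux, priorD_succ_singleton_nil, Finset.prod_singleton,
      List.nil_append]
    congr 1
    simp only [ih, Finset.prod_univ_sum, Finset.mul_sum]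
    refine Finset.sum_congr (by congr!) fun t ht => ?_
    simp only [Fintype.mem_piFinset, mem_contextTrees] at ht
    rw [priorD_graft hA lam ht, prod_graft, Finset.prod_mul_distrib, mul_assoc]
    simp only [List.append_assoc, List.singleton_append]

end ContextTreeGrafting

/-- Subtree decomposition of the CTW weighted probability: for a string `s` of
length `l ≤ D`, `p^w_{n,s}` is the mixture over all context trees `U` of depth at most `D - l`
of the products of evidences at the grafted leaves `u ++ s`. -/
theorem ctw_subtree_decomposition {𝒜 : Type*} [Fintype 𝒜] [DecidableEq 𝒜]
    (hA : 2 ≤ Fintype.card 𝒜) (D n : ℕ) (hD : 1 ≤ D) (hn : 1 ≤ n)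
    (lam : ℝ) (hlam : lam ∈ Set.Ioo (0 : ℝ) 1)
    (α : 𝒜 → ℝ) (hα : ∀ a, 0 < α a) (x : ℤ → 𝒜)
    (l : ℕ) (hlD : l ≤ D) (s : List 𝒜) (hs : s.length = l) :
    pW α lam x D n s =
      ∑ U ∈ contextTrees 𝒜 (D - l),
        priorD lam (D - l) U * ∏ u ∈ U, pE α x D n (u ++ s) := by
  subst hs
  exact pWaux_eq_sum_contextTrees hA α lam x D n (D - s.length) s
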